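/- For any tetrahedron, the sum of the inradii of its four triangular faces is at least four times the inradius of the tetrahedron: r₁ + r₂ + r₃ + r₄ ≥ 4ρ. -/

import Mathlib

open EuclideanGeometry

/-- Area of a triangle with side lengths x, y, z, by Heron's formula. -/
noncomputable def heronArea (x y z : ℝ) : ℝ :=
  Real.sqrt (((x + y + z) / 2) * ((x + y + z) / 2 - x) * ((x + y + z) / 2 - y) *
    ((x + y + z) / 2 - z))

/-- Inradius of a triangle with side lengths x, y, z. -/
noncomputable def triInradius (x y z : ℝ) : ℝ :=
  heronArea x y z / ((x + y + z) / 2)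

open MeasureTheory Pointwise in
theorem aux_simplex_vol (n : ℕ) :
    volume {x : Fin n → ℝ | (∀ i, 0 ≤ x i) ∧ ∑ i, x i ≤ 1} ≤ ENNReal.ofReal (1 / (n.factorial : ℝ)) := by
  induction n with
  | zero =>
    refine (measure_mono (Set.subset_univ _)).trans ?_
    simp [volume_pi]
  | succ n ih =>
    set T : Set (Fin n → ℝ) := {x | (∀ i, 0 ≤ x i) ∧ ∑ i, x i ≤ 1} with hT
    set T' : Set (Fin (n+1) → ℝ) := {x | (∀ i, 0 ≤ x i) ∧ ∑ i, x i ≤ 1} with hT'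
    have hmp := (volume_preserving_piFinSuccAbove (fun _ : Fin (n + 1) => ℝ) 0).symm
    have hclosed : MeasurableSet T' := by
      have : T' = (⋂ i, {x : Fin (n+1) → ℝ | 0 ≤ x i}) ∩ {x | ∑ i, x i ≤ 1} := by
        ext x; simp [hT']
      rw [this]
      apply IsClosed.measurableSet
      refine IsClosed.inter (isClosed_iInter fun i => isClosed_le (by fun_prop) (by fun_prop)) 
        (isClosed_le (by fun_prop) (by fun_prop))
    rw [← hmp.measure_preimage_equiv, Measure.volume_eq_prod, Measure.prod_apply (hmp.measurable hclosed)]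
    have hle : ∀ t : ℝ, t ≠ 1 → volume (Prod.mk t ⁻¹' ((MeasurableEquiv.piFinSuccAbove (fun _ : Fin (n + 1) => ℝ) 0).symm ⁻¹' T'))
        ≤ (Set.Icc (0:ℝ) 1).indicator (fun t => ENNReal.ofReal ((1 - t) ^ n * (1 / (n.factorial : ℝ)))) t := by
      intro t hne
      by_cases ht : t ∈ Set.Icc (0:ℝ) 1
      · rw [Set.indicator_of_mem ht]
        have h1 : t < 1 := lt_of_le_of_ne ht.2 hne
        have hs : 0 < 1 - t := by linarith
        have hsub : (Prod.mk t ⁻¹' ((MeasurableEquiv.piFinSuccAbove (fun _ : Fin (n + 1) => ℝ) 0).symm ⁻¹' T')) ⊆ (1 - t) • T := by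
          intro x hx
          simp [hT', Fin.sum_univ_succ, Fin.forall_fin_succ] at hx
          rw [Set.mem_smul_set_iff_inv_smul_mem₀ hs.ne']
          refine ⟨fun i => ?_, ?_⟩
          · have := hx.1.2 i
            simp only [Pi.smul_apply, smul_eq_mul]
            positivity
          · simp only [Pi.smul_apply, smul_eq_mul, ← Finset.mul_sum]
            rw [inv_mul_le_iff₀ hs]
            linarith [hx.2]
        refine (measure_mono hsub).trans ?_
        rw [Measure.addHaar_smul, Module.finrank_fin_fun, abs_of_pos (pow_pos hs n),
          ENNReal.ofReal_mul (pow_pos hs n).le]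
        gcongr
      · rw [Set.indicator_of_notMem ht]
        have : (Prod.mk t ⁻¹' ((MeasurableEquiv.piFinSuccAbove (fun _ : Fin (n + 1) => ℝ) 0).symm ⁻¹' T')) = ∅ := by
          ext x
          simp [hT', Fin.sum_univ_succ, Fin.forall_fin_succ]
          intro h0 h1
          have := Finset.sum_nonneg (fun i (_ : i ∈ Finset.univ) => h1 i)
          by_contra hcon
          exact ht ⟨h0, by linarith⟩
        rw [this]; simp
    refine (lintegral_mono_ae (g := (Set.Icc (0:ℝ) 1).indicator
      (fun t => ENNReal.ofReal ((1 - t) ^ n * (1 / (n.factorial : ℝ))))) ?_).trans ?_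
    · filter_upwards [compl_mem_ae_iff.2 (measure_singleton (1:ℝ))] with t ht using hle t ht
    rw [lintegral_indicator measurableSet_Icc]
    rw [← ofReal_integral_eq_lintegral_ofReal]
    · apply ENNReal.ofReal_le_ofReal
      rw [integral_Icc_eq_integral_Ioc, ← intervalIntegral.integral_of_le zero_le_one,
        intervalIntegral.integral_mul_const]
      have := intervalIntegral.integral_comp_sub_left (a := 0) (b := 1) (fun x : ℝ => x ^ n) 1
      rw [this]
      simp [Nat.factorial_succ, mul_comm]
    · exact (by fun_prop : Continuous fun t : ℝ => (1 - t) ^ n * (1 / (n.factorial : ℝ))).integrableOn_Icc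
    · filter_upwards [ae_restrict_mem measurableSet_Icc] with t ht
      have : 0 ≤ 1 - t := by linarith [ht.2]
      simp only [Pi.zero_apply]
      positivity

abbrev E3 := EuclideanSpace ℝ (Fin 3)

/-- Squared norm of the cross product (Q - P) × (R - P). -/
def crSq (P Q R : E3) : ℝ :=
  ((Q 1 - P 1) * (R 2 - P 2) - (Q 2 - P 2) * (R 1 - P 1)) ^ 2 +
  ((Q 2 - P 2) * (R 0 - P 0) - (Q 0 - P 0) * (R 2 - P 2)) ^ 2 +
  ((Q 0 - P 0) * (R 1 - P 1) - (Q 1 - P 1) * (R 0 - P 0)) ^ 2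

def det4 (P Q R T : E3) : ℝ :=
  (Q 0 - P 0) * ((R 1 - P 1) * (T 2 - P 2) - (R 2 - P 2) * (T 1 - P 1)) +
  (Q 1 - P 1) * ((R 2 - P 2) * (T 0 - P 0) - (R 0 - P 0) * (T 2 - P 2)) +
  (Q 2 - P 2) * ((R 0 - P 0) * (T 1 - P 1) - (R 1 - P 1) * (T 0 - P 0))

noncomputable def area (P Q R : E3) : ℝ := Real.sqrt (crSq P Q R) / 2

theorem aux_dist_sq (P Q : E3) :
    dist P Q ^ 2 = (Q 0 - P 0) ^ 2 + (Q 1 - P 1) ^ 2 + (Q 2 - P 2) ^ 2 := by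
  rw [EuclideanSpace.dist_eq, Real.sq_sqrt (by positivity)]
  simp [Fin.sum_univ_three, Real.dist_eq, sq_abs]
  ring

theorem heron_eq (P Q R : E3) :
    heronArea (dist P Q) (dist Q R) (dist R P) = area P Q R := by
  have h1 := aux_dist_sq P Q
  have h2 := aux_dist_sq Q R
  have h3 := aux_dist_sq R P
  unfold heronArea area
  generalize dist P Q = x at *
  generalize dist Q R = y at *
  generalize dist R P = z at *
  have : (x + y + z) / 2 * ((x + y + z) / 2 - x) * ((x + y + z) / 2 - y) * ((x + y + z) / 2 - z)
      = crSq P Q R / 2 ^ 2 := by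
    have e : (x + y + z) / 2 * ((x + y + z) / 2 - x) * ((x + y + z) / 2 - y) * ((x + y + z) / 2 - z)
      = (4 * x ^ 2 * z ^ 2 - (x ^ 2 + z ^ 2 - y ^ 2) ^ 2) / 16 := by ring
    rw [e, h1, h2, h3]
    unfold crSq
    ring
  rw [this, Real.sqrt_div' _ (by positivity), Real.sqrt_sq (by norm_num)]

theorem area_nonneg (P Q R : E3) : 0 ≤ area P Q R := by unfold area; positivity

theorem area_rot (P Q R : E3) : area P Q R = area Q R P := by
  unfold area crSq; congr 2; ring

theorem area_swap (P Q R : E3) : area P Q R = area Q P R := by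
  unfold area crSq; congr 2; ring

theorem area_sq (P Q R : E3) : area P Q R ^ 2 = crSq P Q R / 4 := by
  unfold area
  rw [div_pow, Real.sq_sqrt (by unfold crSq; positivity)]; norm_num

theorem area_key (P Q R T : E3) :
    dist P Q * |det4 P Q R T| ≤ 4 * (area P Q R * area P Q T) := by
  have h1 := area_nonneg P Q R
  have h2 := area_nonneg P Q T
  apply le_of_sq_le_sq _ (by positivity)
  rw [mul_pow, mul_pow, mul_pow, sq_abs, area_sq, area_sq, aux_dist_sq]
  unfold det4 crSq
  generalize Q 0 - P 0 = u0
  generalize Q 1 - P 1 = u1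
  generalize Q 2 - P 2 = u2
  generalize R 0 - P 0 = v0
  generalize R 1 - P 1 = v1
  generalize R 2 - P 2 = v2
  generalize T 0 - P 0 = w0
  generalize T 1 - P 1 = w1
  generalize T 2 - P 2 = w2
  have := sq_nonneg ((u1 * v2 - u2 * v1) * (u1 * w2 - u2 * w1) +
    (u2 * v0 - u0 * v2) * (u2 * w0 - u0 * w2) + (u0 * v1 - u1 * v0) * (u0 * w1 - u1 * w0))
  linarith

open MeasureTheory in
theorem vol_le (A B C D : E3) :
    (volume (convexHull ℝ {A, B, C, D})).toReal ≤ |det4 A B C D| / 6 := by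
  set T : Set (Fin 3 → ℝ) := {x | (∀ i, 0 ≤ x i) ∧ ∑ i, x i ≤ 1} with hT
  let M : Matrix (Fin 3) (Fin 3) ℝ :=
    !![B 0 - A 0, C 0 - A 0, D 0 - A 0; B 1 - A 1, C 1 - A 1, D 1 - A 1;
       B 2 - A 2, C 2 - A 2, D 2 - A 2]
  let K : Set (Fin 3 → ℝ) := (fun x => WithLp.ofLp A + x) '' (Matrix.toLin' M '' T)
  have hdet : LinearMap.det (Matrix.toLin' M) = det4 A B C D := by
    rw [LinearMap.det_toLin', Matrix.det_fin_three]
    simp [M, det4]; ring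
  have hTc : Convex ℝ T := by
    have : T = (⋂ i, {x : Fin 3 → ℝ | 0 ≤ x i}) ∩ {x | ∑ i, x i ≤ 1} := by
      ext x; simp [hT]
    rw [this]
    refine Convex.inter (convex_iInter fun i => convex_halfSpace_ge (LinearMap.isLinear (LinearMap.proj i)) 0) ?_
    exact convex_halfSpace_le (IsLinearMap.mk (by intros; simp [Finset.sum_add_distrib])
      (by intros; simp [Finset.mul_sum])) 1
  have hKc : Convex ℝ K := (hTc.linear_image _).translate _
  have hKv : volume K ≤ ENNReal.ofReal (|det4 A B C D| / 6) := by
    simp only [K]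
    rw [Set.image_add_left, measure_preimage_add, Measure.addHaar_image_linearMap, hdet]
    have h := aux_simplex_vol 3
    refine (mul_le_mul_right h _).trans ?_
    rw [← ENNReal.ofReal_mul (abs_nonneg _)]
    apply ENNReal.ofReal_le_ofReal
    norm_num [Nat.factorial]
    linarith
  have hsub : convexHull ℝ {A, B, C, D} ⊆ (MeasurableEquiv.toLp 2 (Fin 3 → ℝ)).symm ⁻¹' K := by
    apply convexHull_min
    · have key : ∀ x ∈ T, ∀ P : E3, WithLp.ofLp A + M.mulVec x = WithLp.ofLp P →
          P ∈ (MeasurableEquiv.toLp 2 (Fin 3 → ℝ)).symm ⁻¹' K := by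
        intro x hx P h
        exact ⟨_, ⟨x, hx, rfl⟩, by simpa using h⟩
      rintro P (rfl | rfl | rfl | rfl)
      · refine key 0 (by simp [hT]) _ (by simp)
      · refine key ![1, 0, 0] (by simp [hT, Fin.forall_fin_succ, Fin.sum_univ_succ]) _ ?_
        ext i; fin_cases i <;> simp [M, Matrix.mulVec, dotProduct, Fin.sum_univ_succ]
      · refine key ![0, 1, 0] (by simp [hT, Fin.forall_fin_succ, Fin.sum_univ_succ]) _ ?_
        ext i; fin_cases i <;> simp [M, Matrix.mulVec, dotProduct, Fin.sum_univ_succ]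
      · refine key ![0, 0, 1] (by simp [hT, Fin.forall_fin_succ, Fin.sum_univ_succ]) _ ?_
        ext i; fin_cases i <;> simp [M, Matrix.mulVec, dotProduct, Fin.sum_univ_succ]
    · exact hKc.linear_preimage (WithLp.linearEquiv 2 ℝ (Fin 3 → ℝ)).toLinearMap
  apply ENNReal.toReal_le_of_le_ofReal (by positivity)
  refine (measure_mono hsub).trans ?_
  rw [(EuclideanSpace.volume_preserving_symm_measurableEquiv_toLp (Fin 3)).measure_preimage_equiv]
  exact hKv

theorem face_bound (P Q R T : E3) (V S : ℝ) (hPQ : P ≠ Q)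
    (hV : V ≤ |det4 P Q R T| / 6)
    (hS : S = area P Q R + area P Q T + area Q R T + area R P T) :
    3 * V / S ≤ triInradius (dist P Q) (dist Q R) (dist R P) := by
  unfold triInradius
  rw [heron_eq]
  have hp : 0 < dist P Q := dist_pos.2 hPQ
  have n2 : 0 ≤ dist Q R := dist_nonneg
  have n3 : 0 ≤ dist R P := dist_nonneg
  have a0 := area_nonneg P Q R
  have a1 := area_nonneg P Q T
  have a2 := area_nonneg Q R T
  have a3 := area_nonneg R P T
  have k1 := area_key P Q R T
  have k2 := area_key Q R P T
  have k3 := area_key R P Q T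
  have d2 : det4 Q R P T = det4 P Q R T := by unfold det4; ring
  have d3 : det4 R P Q T = det4 P Q R T := by unfold det4; ring
  rw [d2, ← area_rot] at k2
  rw [d3, area_rot] at k3
  have hS0 : 0 ≤ S := by rw [hS]; positivity
  rcases eq_or_lt_of_le hS0 with h | h
  · rw [← h, div_zero]; positivity
  rw [div_le_div_iff₀ h (by positivity)]
  have : V * (dist P Q + dist Q R + dist R P) ≤ |det4 P Q R T| / 6 * (dist P Q + dist Q R + dist R P) :=
    mul_le_mul_of_nonneg_right hV (by positivity)
  rw [hS]
  nlinarith [mul_nonneg a0 a0]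

theorem stmt_7 (A B C D : EuclideanSpace ℝ (Fin 3))
    (hABCD : AffineIndependent ℝ ![A, B, C, D])
    (r₁ r₂ r₃ r₄ V S ρ : ℝ)
    (hr1 : r₁ = triInradius (dist A B) (dist B C) (dist C A))
    (hr2 : r₂ = triInradius (dist A C) (dist C D) (dist D A))
    (hr3 : r₃ = triInradius (dist A B) (dist B D) (dist D A))
    (hr4 : r₄ = triInradius (dist B C) (dist C D) (dist D B))
    (hV : V = (MeasureTheory.volume (convexHull ℝ {A, B, C, D})).toReal)
    (hS : S = heronArea (dist A B) (dist B C) (dist C A) +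
        heronArea (dist A C) (dist C D) (dist D A) +
        heronArea (dist A B) (dist B D) (dist D A) +
        heronArea (dist B C) (dist C D) (dist D B))
    (hρ : ρ = 3 * V / S) :
    r₁ + r₂ + r₃ + r₄ ≥ 4 * ρ := by
  have inj := hABCD.injective
  have hAB : A ≠ B := fun h => by simpa using @inj 0 1 (by simpa using h)
  have hAC : A ≠ C := fun h => by simpa using @inj 0 2 (by simpa using h)
  have hBC : B ≠ C := fun h => by simpa using @inj 1 2 (by simpa using h)
  have hv := vol_le A B C D
  rw [← hV] at hv
  rw [heron_eq, heron_eq, heron_eq, heron_eq] at hS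
  have e1 : |det4 A C D B| = |det4 A B C D| := by congr 1; unfold det4; ring
  have e2 : |det4 A B D C| = |det4 A B C D| := by
    rw [← abs_neg]; congr 1; unfold det4; ring
  have e3 : |det4 B C D A| = |det4 A B C D| := by
    rw [← abs_neg]; congr 1; unfold det4; ring
  have b1 := face_bound A B C D V S hAB hv (by
    rw [hS, area_swap C A D]; ring)
  have b2 := face_bound A C D B V S hAC (by rw [e1]; exact hv) (by
    rw [hS, area_rot A B C, area_rot B C A, area_swap C A B, area_rot B C D, area_rot D A B]; ring)
  have b3 := face_bound A B D C V S hAB (by rw [e2]; exact hv) (by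
    rw [hS, ← area_rot C B D, area_swap C B D, area_rot D A C]; ring)
  have b4 := face_bound B C D A V S hBC (by rw [e3]; exact hv) (by
    rw [hS, area_rot A B C, area_rot A C D, area_rot D B A, area_swap B A D]; ring)
  rw [hr1, hr2, hr3, hr4, hρ]
  linarith
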